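/- arXiv:math/0105056 — 2 statements merged into one kernel-verified Lean document; each statement's English description precedes it below -/
import Mathlib

section
/- If the scaled ABS recursions are carried out with nonzero denominators through all m steps and the scaling vectors v₁,…,v_m ∈ ℝ^m are linearly independent, then the final iterate solves the system: A x_{m+1} = b. -/
open Matrix

/-- A scaled rank-one ABS update acts on `u` by subtracting a multiple of `H *ᵥ y`. -/
lemma abs_update_mulVec {n : ℕ} (H : Matrix (Fin n) (Fin n) ℝ) (w y u : Fin n → ℝ) :
    (H - (w ⬝ᵥ (H *ᵥ y))⁻¹ • vecMulVec (H *ᵥ y) (w ᵥ* H)) *ᵥ u =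
      H *ᵥ u - ((w ⬝ᵥ (H *ᵥ y))⁻¹ * (w ⬝ᵥ (H *ᵥ u))) • (H *ᵥ y) := by
  rw [sub_mulVec, smul_mulVec, vecMulVec_mulVec, ← dotProduct_mulVec, mul_smul]
  simp

/-- A vector orthogonal to `m` linearly independent vectors of `ℝ^m` vanishes. -/
lemma eq_zero_of_linearIndependent_dotProduct {m : ℕ} {v : Fin m → Fin m → ℝ}
    (hv : LinearIndependent ℝ v) {r : Fin m → ℝ} (h : ∀ k, v k ⬝ᵥ r = 0) : r = 0 := by
  have hu : IsUnit (Matrix.of v) := linearIndependent_rows_iff_isUnit.mp hv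
  refine mulVec_injective_of_isUnit hu ?_
  rw [mulVec_zero]
  exact funext h

/-- If the scaled ABS recursions are carried out with nonzero
denominators through all `m` steps and the scaling vectors `v₁,…,v_m ∈ ℝ^m`
are linearly independent, then the final iterate solves the system:
`A x_{m+1} = b` (here `x m`). -/
theorem abs_finite_termination
    {m n : ℕ} (hmn : m ≤ n)
    (A : Matrix (Fin m) (Fin n) ℝ) (b : Fin m → ℝ)
    (H : ℕ → Matrix (Fin n) (Fin n) ℝ) (x : ℕ → Fin n → ℝ)
    (v : ℕ → Fin m → ℝ) (z w : ℕ → Fin n → ℝ)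
    (p : ℕ → Fin n → ℝ) (α : ℕ → ℝ)
    (hH1 : (H 0).det ≠ 0)
    (hv : LinearIndependent ℝ (fun k : Fin m => v k.1))
    (hp : ∀ k < m, p k = (H k)ᵀ *ᵥ z k)
    (hα : ∀ k < m, α k = (v k ⬝ᵥ (A *ᵥ x k - b)) / (v k ⬝ᵥ (A *ᵥ p k)))
    (hx : ∀ k < m, x (k + 1) = x k - α k • p k)
    (hd1 : ∀ k < m, v k ⬝ᵥ (A *ᵥ ((H k)ᵀ *ᵥ z k)) ≠ 0)
    (hd2 : ∀ k < m, w k ⬝ᵥ (H k *ᵥ (Aᵀ *ᵥ v k)) ≠ 0)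
    (hH : ∀ k < m, H (k + 1) =
      H k - (w k ⬝ᵥ (H k *ᵥ (Aᵀ *ᵥ v k)))⁻¹ •
        vecMulVec (H k *ᵥ (Aᵀ *ᵥ v k)) (w k ᵥ* H k)) :
    A *ᵥ x m = b := by
  have hker : ∀ k ≤ m, ∀ j < k, H k *ᵥ (Aᵀ *ᵥ v j) = 0 := by
    intro k
    induction k with
    | zero => simp
    | succ k ih =>
      intro hk j hj
      rw [hH k hk, abs_update_mulVec]
      rcases Nat.lt_succ_iff_lt_or_eq.mp hj with hjk | rfl
      · rw [ih (Nat.le_of_succ_le hk) j hjk, dotProduct_zero, mul_zero, zero_smul, sub_zero]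
      · rw [inv_mul_cancel₀ (hd2 j hk), one_smul, sub_self]
  have horth : ∀ k < m, ∀ j < k, v j ⬝ᵥ (A *ᵥ p k) = 0 := by
    intro k hk j hj
    rw [hp k hk, dotProduct_mulVec, dotProduct_mulVec, vecMul_transpose, ← mulVec_transpose,
      hker k hk.le j hj, zero_dotProduct]
  have hres : ∀ k ≤ m, ∀ j < k, v j ⬝ᵥ (A *ᵥ x k - b) = 0 := by
    intro k
    induction k with
    | zero => simp
    | succ k ih =>
      intro hk j hj
      have hstep : v j ⬝ᵥ (A *ᵥ x (k + 1) - b) =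
          v j ⬝ᵥ (A *ᵥ x k - b) - α k * (v j ⬝ᵥ (A *ᵥ p k)) := by
        rw [hx k hk, mulVec_sub, mulVec_smul, sub_right_comm, dotProduct_sub,
          dotProduct_smul, smul_eq_mul]
      rw [hstep]
      rcases Nat.lt_succ_iff_lt_or_eq.mp hj with hjk | rfl
      · rw [ih (Nat.le_of_succ_le hk) j hjk, horth k hk j hjk, mul_zero, sub_zero]
      · rw [hα j hk, div_mul_cancel₀ _ (by rw [hp j hk]; exact hd1 j hk), sub_self]
  exact sub_eq_zero.mp (eq_zero_of_linearIndependent_dotProduct hv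
    fun k => hres m le_rfl k k.2)
end

section
/- Suppose m < n, A has rank m, the scaling vectors v₁,…,v_m are linearly independent, and the scaled ABS recursions are carried out with nonzero denominators through all m steps. Then a vector x ∈ ℝⁿ satisfies A x = b if and only if x = x_{m+1} + H_{m+1}ᵀ q for some q ∈ ℝⁿ. -/
open Matrix

theorem dotProduct_mulVec_transpose_mulVec {m n l : Type*} [Fintype m] [Fintype n] [Fintype l]
    {R : Type*} [CommSemiring R]
    (A : Matrix m n R) (H : Matrix l n R) (v : m → R) (q : l → R) :
    v ⬝ᵥ (A *ᵥ (Hᵀ *ᵥ q)) = (H *ᵥ (Aᵀ *ᵥ v)) ⬝ᵥ q := by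
  rw [dotProduct_mulVec, dotProduct_mulVec, vecMul_transpose, mulVec_transpose]

theorem eq_zero_of_linearIndependent_of_dotProduct_eq_zero {ι K : Type*} [Fintype ι] [Field K]
    {v : ι → ι → K} (hv : LinearIndependent K v) {y : ι → K} (h : ∀ i, v i ⬝ᵥ y = 0) : y = 0 := by
  classical
  have hU : IsUnit (Matrix.of v) := linearIndependent_rows_iff_isUnit.mp hv
  refine mulVec_injective_of_isUnit hU ?_
  rw [mulVec_zero]
  exact funext h

/-- The rank-one update of the Abaffian, applied to a vector. -/
theorem sub_smul_vecMulVec_mulVec {n K : Type*} [Fintype n] [CommRing K]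
    (H : Matrix n n K) (c : K) (u w a : n → K) :
    (H - c • vecMulVec u (w ᵥ* H)) *ᵥ a = H *ᵥ a - (c * (w ⬝ᵥ (H *ᵥ a))) • u := by
  rw [sub_mulVec, smul_mulVec, vecMulVec_mulVec, op_smul_eq_smul, smul_smul, dotProduct_mulVec]

/-- The transposed rank-one update of the Abaffian, applied to a vector. -/
theorem sub_smul_vecMulVec_transpose_mulVec {n K : Type*} [Fintype n] [CommRing K]
    (H : Matrix n n K) (c : K) (u w q : n → K) :
    (H - c • vecMulVec u (w ᵥ* H))ᵀ *ᵥ q = Hᵀ *ᵥ q - (c * (u ⬝ᵥ q)) • (w ᵥ* H) := by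
  rw [transpose_sub, transpose_smul, transpose_vecMulVec, sub_mulVec, smul_mulVec,
    vecMulVec_mulVec, op_smul_eq_smul, smul_smul]

/-- Suppose `m < n`, `A` has rank `m`, the scaling vectors
`v₁,…,v_m` are linearly independent, and the scaled ABS recursions are carried
out with nonzero denominators through all `m` steps. Then `y ∈ ℝⁿ` satisfies
`A y = b` iff `y = x_{m+1} + H_{m+1}ᵀ q` for some `q ∈ ℝⁿ` (here `x m`, `H m`). -/
theorem abs_general_solution
    {m n : ℕ} (hmn : m < n)
    (A : Matrix (Fin m) (Fin n) ℝ) (b : Fin m → ℝ)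
    (hrank : A.rank = m)
    (H : ℕ → Matrix (Fin n) (Fin n) ℝ) (x : ℕ → Fin n → ℝ)
    (v : ℕ → Fin m → ℝ) (z w : ℕ → Fin n → ℝ)
    (p : ℕ → Fin n → ℝ) (α : ℕ → ℝ)
    (hH1 : (H 0).det ≠ 0)
    (hv : LinearIndependent ℝ (fun k : Fin m => v k.1))
    (hp : ∀ k < m, p k = (H k)ᵀ *ᵥ z k)
    (hα : ∀ k < m, α k = (v k ⬝ᵥ (A *ᵥ x k - b)) / (v k ⬝ᵥ (A *ᵥ p k)))
    (hx : ∀ k < m, x (k + 1) = x k - α k • p k)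
    (hd1 : ∀ k < m, v k ⬝ᵥ (A *ᵥ ((H k)ᵀ *ᵥ z k)) ≠ 0)
    (hd2 : ∀ k < m, w k ⬝ᵥ (H k *ᵥ (Aᵀ *ᵥ v k)) ≠ 0)
    (hH : ∀ k < m, H (k + 1) =
      H k - (w k ⬝ᵥ (H k *ᵥ (Aᵀ *ᵥ v k)))⁻¹ •
        vecMulVec (H k *ᵥ (Aᵀ *ᵥ v k)) (w k ᵥ* H k)) :
    ∀ y : Fin n → ℝ, A *ᵥ y = b ↔ ∃ q : Fin n → ℝ, y = x m + (H m)ᵀ *ᵥ q := by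
  have hker : ∀ k ≤ m, ∀ j < k, H k *ᵥ (Aᵀ *ᵥ v j) = 0 := by
    intro k
    induction k with
    | zero => intro _ j hj; omega
    | succ k ih =>
      intro hk j hj
      rw [hH k hk, sub_smul_vecMulVec_mulVec]
      rcases Nat.lt_succ_iff_lt_or_eq.mp hj with hj | rfl
      · simp [ih (by omega) j hj]
      · rw [inv_mul_cancel₀ (hd2 j hk), one_smul, sub_self]
  have hres : ∀ k ≤ m, ∀ j < k, v j ⬝ᵥ (A *ᵥ x k - b) = 0 := by
    intro k
    induction k with
    | zero => intro _ j hj; omega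
    | succ k ih =>
      intro hk j hj
      have hstep : v j ⬝ᵥ (A *ᵥ x (k + 1) - b) =
          v j ⬝ᵥ (A *ᵥ x k - b) - α k * (v j ⬝ᵥ (A *ᵥ p k)) := by
        rw [hx k hk, mulVec_sub, mulVec_smul, sub_right_comm, dotProduct_sub,
          dotProduct_smul, smul_eq_mul]
      rw [hstep]
      rcases Nat.lt_succ_iff_lt_or_eq.mp hj with hj | rfl
      · rw [ih (by omega) j hj, hp k hk, dotProduct_mulVec_transpose_mulVec,
          hker k (by omega) j hj, zero_dotProduct, mul_zero, sub_zero]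
      · have hne := hd1 j hk
        rw [← hp j hk] at hne
        rw [hα j hk, div_mul_cancel₀ _ hne, sub_self]
  have hrange : ∀ d, A *ᵥ d = 0 → ∀ k ≤ m, ∃ q, d = (H k)ᵀ *ᵥ q := by
    intro d hd k
    induction k with
    | zero =>
      intro _
      have hU : IsUnit (H 0)ᵀ.det := by rw [det_transpose]; exact hH1.isUnit
      exact ⟨(H 0)ᵀ⁻¹ *ᵥ d, by rw [mulVec_mulVec, mul_nonsing_inv _ hU, one_mulVec]⟩
    | succ k ih =>
      intro hk
      obtain ⟨q, hq⟩ := ih (by omega)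
      refine ⟨q, ?_⟩
      rw [hH k hk, sub_smul_vecMulVec_transpose_mulVec, ← dotProduct_mulVec_transpose_mulVec,
        ← hq, hd, dotProduct_zero, mul_zero, zero_smul, sub_zero]
  have hsol : A *ᵥ x m = b :=
    sub_eq_zero.mp <| eq_zero_of_linearIndependent_of_dotProduct_eq_zero hv
      fun j => hres m le_rfl j j.2
  have hnull : ∀ q, A *ᵥ ((H m)ᵀ *ᵥ q) = 0 := fun q =>
    eq_zero_of_linearIndependent_of_dotProduct_eq_zero hv fun j => by
      rw [dotProduct_mulVec_transpose_mulVec, hker m le_rfl j j.2, zero_dotProduct]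
  intro y
  constructor
  · intro hy
    obtain ⟨q, hq⟩ := hrange (y - x m) (by rw [mulVec_sub, hy, hsol, sub_self]) m le_rfl
    exact ⟨q, by rw [← hq, add_sub_cancel]⟩
  · rintro ⟨q, rfl⟩
    rw [mulVec_add, hsol, hnull, add_zero]
end
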